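/- arXiv:1708.02639 — 2 statements merged into one kernel-verified Lean document; each statement's English description precedes it below -/
import Mathlib

section
/- If a matrix M : A × X → {-1,1} (A, X finite sets) is a (k, ℓ ∼ r)-L∞-extractor, then for every ξ with 1 ≤ ξ ≤ ℓ−1, M is a (k−1, (ℓ−ξ−1)/2)-L₂-extractor with error 2^{-r} + 2^{-ξ+1}; that is, for every non-negative f : X → ℝ that is not identically zero and satisfies ‖f‖₂ ≤ 2^{(ℓ−ξ−1)/2}·‖f‖₁, there are at most 2^{-(k−1)}·|A| elements a ∈ A with |⟨M_a,f⟩| ≥ (2^{-r} + 2^{-ξ+1})·‖f‖₁. -/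
open Finset

attribute [local instance] Classical.propDecidable

/-- Expectation with respect to the uniform distribution on a finite set. -/
noncomputable def expE {X : Type*} [Fintype X] (f : X → ℝ) : ℝ :=
  (∑ x, f x) / (Fintype.card X)

/-- Inner product with respect to the uniform distribution. -/
noncomputable def nInner {X : Type*} [Fintype X] (f g : X → ℝ) : ℝ :=
  expE (fun x => f x * g x)

/-- Normalized ℓ₁-norm. -/
noncomputable def nNorm1 {X : Type*} [Fintype X] (f : X → ℝ) : ℝ :=
  expE (fun x => |f x|)

/-- Normalized ℓ₂-norm. -/
noncomputable def nNorm2 {X : Type*} [Fintype X] (f : X → ℝ) : ℝ :=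
  Real.sqrt (expE (fun x => (f x) ^ 2))

/-- `M` is a `(k,ℓ)`-L₂-extractor with error `2^{-r}`. -/
def IsL2Extractor {A X : Type*} [Fintype A] [Fintype X]
    (M : A → X → ℝ) (k ℓ r : ℝ) : Prop :=
  ∀ f : X → ℝ, (∀ x, 0 ≤ f x) → f ≠ 0 →
    nNorm2 f ≤ (2 : ℝ) ^ ℓ * nNorm1 f →
    ((Finset.univ.filter
        (fun a : A => (2 : ℝ) ^ (-r) * nNorm1 f ≤ |nInner (M a) f|)).card : ℝ)
      ≤ (2 : ℝ) ^ (-k) * (Fintype.card A)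

/-- `M` is a `(k, ℓ ∼ r)`-L∞-extractor: for all probability distributions
`p_a` on `A` with min-entropy at least `log₂|A| - k` and `p_x` on `X` with
min-entropy at least `log₂|X| - ℓ`, the `(p_a, p_x)`-average of `M` has
absolute value at most `2^{-r}`. -/
def IsLinfExtractor {A X : Type*} [Fintype A] [Fintype X]
    (M : A → X → ℝ) (k ℓ r : ℝ) : Prop :=
  ∀ pa : A → ℝ, (∀ a, 0 ≤ pa a) → (∑ a, pa a) = 1 →
    (∀ a, pa a ≤ (2 : ℝ) ^ (-(Real.logb 2 (Fintype.card A) - k))) →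
  ∀ px : X → ℝ, (∀ x, 0 ≤ px x) → (∑ x, px x) = 1 →
    (∀ x, px x ≤ (2 : ℝ) ^ (-(Real.logb 2 (Fintype.card X) - ℓ))) →
    |∑ a, ∑ x, pa a * px x * M a x| ≤ (2 : ℝ) ^ (-r)

/-- A distribution with small collision probability is close in total variation to a bounded
one, obtained by conditioning on its small values. -/
theorem exists_bounded_distribution_near {X : Type*} [Fintype X] (p : X → ℝ)
    (hp : ∀ x, 0 ≤ p x) (hp1 : ∑ x, p x = 1) {t ε : ℝ} (ht : 0 < t) (hε : 0 < ε)
    (hε2 : ε ≤ 1 / 2) (hcoll : ∑ x, p x ^ 2 ≤ t * ε) :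
    ∃ q : X → ℝ, (∀ x, 0 ≤ q x) ∧ ∑ x, q x = 1 ∧ (∀ x, q x ≤ 2 * t) ∧
      ∑ x, |q x - p x| < 2 * ε := by
  set b : ℝ := ∑ x, if t < p x then p x else 0 with hb
  have hb0 : 0 ≤ b := Finset.sum_nonneg fun x _ => by split_ifs <;> simp [hp x]
  have hbε : b < ε := by
    by_cases hB : ∃ x, t < p x
    · obtain ⟨x₀, hx₀⟩ := hB
      have h1 : t * b < ∑ x, p x ^ 2 := by
        rw [hb, Finset.mul_sum]
        refine Finset.sum_lt_sum (fun x _ => ?_) ⟨x₀, Finset.mem_univ _, ?_⟩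
        · split_ifs with h
          · nlinarith [hp x]
          · simpa using sq_nonneg (p x)
        · rw [if_pos hx₀]
          nlinarith
      exact lt_of_mul_lt_mul_left (h1.trans_le hcoll) ht.le
    · push Not at hB
      have : b = 0 := Finset.sum_eq_zero fun x _ => if_neg (hB x).not_gt
      linarith
  have hb2 : 1 / 2 < 1 - b := by linarith
  have hpos : 0 < 1 - b := by linarith
  have hsmall : ∑ x, (if t < p x then 0 else p x) = 1 - b := by
    rw [← hp1, hb, ← Finset.sum_sub_distrib]
    exact Finset.sum_congr rfl fun x _ => by split_ifs <;> simp
  refine ⟨fun x => (if t < p x then 0 else p x) / (1 - b), fun x => ?_, ?_, fun x => ?_, ?_⟩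
  · have := hp x
    dsimp only
    split_ifs <;> positivity
  · rw [← Finset.sum_div, hsmall, div_self hpos.ne']
  · dsimp only
    rw [div_le_iff₀ hpos]
    split_ifs with h
    · positivity
    · push Not at h
      nlinarith
  · have hdiff : ∀ x, |(if t < p x then 0 else p x) / (1 - b) - p x| =
        (if t < p x then p x else 0) + (if t < p x then 0 else p x) * (b / (1 - b)) := by
      intro x
      split_ifs
      · simp [abs_of_nonneg (hp x)]
      · have h2 : p x / (1 - b) - p x = p x * (b / (1 - b)) := by
          field_simp
          ring
        rw [h2, zero_add, abs_of_nonneg (mul_nonneg (hp x) (by positivity))]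
    rw [Finset.sum_congr rfl fun x _ => hdiff x, Finset.sum_add_distrib, ← Finset.sum_mul,
      hsmall, ← hb, mul_div_cancel₀ _ hpos.ne']
    linarith

theorem two_rpow_neg_logb_sub {n : ℝ} (hn : 0 < n) (k : ℝ) :
    (2 : ℝ) ^ (-(Real.logb 2 n - k)) = 2 ^ k / n := by
  rw [neg_sub, Real.rpow_sub two_pos, Real.rpow_logb two_pos (by norm_num) hn]

/-- Only few rows of an `L∞`-extractor have a large average of prescribed sign against a
bounded distribution. -/
theorem IsLinfExtractor.card_le {A X : Type*} [Fintype A] [Fintype X] {M : A → X → ℝ}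
    {k ℓ r : ℝ} (hext : IsLinfExtractor M k ℓ r) {q : X → ℝ} (hq : ∀ x, 0 ≤ q x)
    (hq1 : ∑ x, q x = 1)
    (hqle : ∀ x, q x ≤ (2 : ℝ) ^ (-(Real.logb 2 (Fintype.card X) - ℓ)))
    {σ : ℝ} (hσ : |σ| = 1) (S : Finset A)
    (hS : ∀ a ∈ S, (2 : ℝ) ^ (-r) < σ * ∑ x, q x * M a x) :
    (S.card : ℝ) ≤ (2 : ℝ) ^ (-k) * Fintype.card A := by
  by_contra! hlt
  have hc : (0 : ℝ) < S.card := lt_of_le_of_lt (by positivity) hlt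
  have hne : S.Nonempty := Finset.card_pos.mp (by exact_mod_cast hc)
  have hA : (0 : ℝ) < Fintype.card A := by
    exact_mod_cast Fintype.card_pos_iff.mpr ⟨hne.choose⟩
  have h := hext (fun a => if a ∈ S then (S.card : ℝ)⁻¹ else 0)
    (fun a => by split_ifs <;> positivity)
    (by simp [Finset.sum_ite_mem, hc.ne'])
    (fun a => by
      rw [two_rpow_neg_logb_sub hA]
      split_ifs
      · rw [Real.rpow_neg two_pos.le] at hlt
        rw [inv_le_comm₀ hc (by positivity), inv_div, div_eq_inv_mul]
        exact hlt.le
      · positivity)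
    q hq hq1 hqle
  have hsum : ∑ a, ∑ x, (if a ∈ S then (S.card : ℝ)⁻¹ else 0) * q x * M a x =
      (S.card : ℝ)⁻¹ * ∑ a ∈ S, ∑ x, q x * M a x := by
    simp_rw [mul_assoc, ← Finset.mul_sum, ite_mul, zero_mul, Finset.sum_ite_mem,
      Finset.univ_inter, ← Finset.mul_sum]
  rw [hsum] at h
  have hbig : (S.card : ℝ) * (2 : ℝ) ^ (-r) < σ * ∑ a ∈ S, ∑ x, q x * M a x := by
    rw [Finset.mul_sum, ← nsmul_eq_mul, ← Finset.sum_const]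
    exact Finset.sum_lt_sum_of_nonempty hne hS
  have habs : σ * ∑ a ∈ S, ∑ x, q x * M a x ≤ |∑ a ∈ S, ∑ x, q x * M a x| := by
    refine (le_abs_self _).trans ?_
    rw [abs_mul, hσ, one_mul]
  rw [abs_mul, abs_of_pos (inv_pos.mpr hc), inv_mul_le_iff₀ hc] at h
  linarith

/-- **Lemma (L∞-extractor implies L₂-extractor).**
If `M` is a `(k, ℓ ∼ r)`-L∞-extractor, then for every `1 ≤ ξ ≤ ℓ-1`, `M` is a
`(k-1, (ℓ-ξ-1)/2)`-L₂-extractor with error `2^{-r} + 2^{-ξ+1}`: for every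
non-negative nonzero `f : X → ℝ` with `‖f‖₂ ≤ 2^{(ℓ-ξ-1)/2}·‖f‖₁`, there are
at most `2^{-(k-1)}·|A|` rows `a` with
`|⟨M_a,f⟩| ≥ (2^{-r} + 2^{-ξ+1})·‖f‖₁`. -/
theorem linfExtractor_to_l2Extractor {A X : Type*} [Fintype A] [Fintype X]
    (M : A → X → ℝ) (hM : ∀ a x, M a x = 1 ∨ M a x = -1)
    (k ℓ r : ℝ) (hext : IsLinfExtractor M k ℓ r) :
    ∀ ξ : ℝ, 1 ≤ ξ → ξ ≤ ℓ - 1 →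
      ∀ f : X → ℝ, (∀ x, 0 ≤ f x) → f ≠ 0 →
        nNorm2 f ≤ (2 : ℝ) ^ ((ℓ - ξ - 1) / 2) * nNorm1 f →
        ((Finset.univ.filter
            (fun a : A =>
              ((2 : ℝ) ^ (-r) + (2 : ℝ) ^ (-ξ + 1)) * nNorm1 f ≤ |nInner (M a) f|)).card : ℝ)
          ≤ (2 : ℝ) ^ (-(k - 1)) * (Fintype.card A : ℝ) := by
  intro ξ hξ _ f hf hf0 hnorm
  obtain ⟨x₀, hx₀⟩ : ∃ x, f x ≠ 0 := Function.ne_iff.mp hf0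
  have hn : (0 : ℝ) < Fintype.card X := by
    exact_mod_cast Fintype.card_pos_iff.mpr ⟨x₀⟩
  set n : ℝ := (Fintype.card X : ℝ) with hn_def
  set s : ℝ := ∑ x, f x with hs_def
  have hs : 0 < s := Finset.sum_pos' (fun x _ => hf x)
    ⟨x₀, Finset.mem_univ _, lt_of_le_of_ne (hf x₀) hx₀.symm⟩
  have hnorm1 : nNorm1 f = s / n := by
    simp only [nNorm1, expE, abs_of_nonneg (hf _), hs_def, hn_def]
  have hp1 : ∑ x, f x / s = 1 := by rw [← Finset.sum_div, div_self hs.ne']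
  have hcoll : ∑ x, (f x / s) ^ 2 ≤ (2 : ℝ) ^ (ℓ - 1) / n * 2 ^ (-ξ) := by
    rw [hnorm1, nNorm2, Real.sqrt_le_left (by positivity), mul_pow, ← Real.rpow_mul_natCast
      two_pos.le, expE, ← hn_def] at hnorm
    have he : (ℓ - ξ - 1) / 2 * ((2 : ℕ) : ℝ) = (ℓ - 1) + -ξ := by push_cast; ring
    rw [he, Real.rpow_add two_pos, div_le_iff₀ hn] at hnorm
    simp_rw [div_pow]
    rw [← Finset.sum_div, div_le_iff₀ (by positivity)]
    refine hnorm.trans_eq ?_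
    field_simp
  have hε2 : (2 : ℝ) ^ (-ξ) ≤ 1 / 2 := by
    calc (2 : ℝ) ^ (-ξ) ≤ 2 ^ (-1 : ℝ) :=
          Real.rpow_le_rpow_of_exponent_le one_le_two (by linarith)
      _ = 1 / 2 := by rw [Real.rpow_neg_one]; norm_num
  obtain ⟨q, hq, hq1, hqle, hqp⟩ := exists_bounded_distribution_near (fun x => f x / s)
    (fun x => div_nonneg (hf x) hs.le) hp1 (by positivity) (by positivity) hε2 hcoll
  have hqle' : ∀ x, q x ≤ (2 : ℝ) ^ (-(Real.logb 2 (Fintype.card X) - ℓ)) := by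
    intro x
    rw [two_rpow_neg_logb_sub hn]
    refine (hqle x).trans_eq ?_
    rw [Real.rpow_sub_one two_ne_zero]
    ring
  have hclose : ∀ a, |∑ x, q x * M a x - ∑ x, f x / s * M a x| < (2 : ℝ) ^ (-ξ + 1) := by
    intro a
    rw [Real.rpow_add_one two_ne_zero, mul_comm, ← Finset.sum_sub_distrib]
    refine lt_of_le_of_lt ((Finset.abs_sum_le_sum_abs _ _).trans_eq
      (Finset.sum_congr rfl fun x _ => ?_)) hqp
    rw [← sub_mul, abs_mul]
    rcases hM a x with h | h <;> simp [h]
  have hbad : ∀ a, ((2 : ℝ) ^ (-r) + (2 : ℝ) ^ (-ξ + 1)) * nNorm1 f ≤ |nInner (M a) f| →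
      (2 : ℝ) ^ (-r) < 1 * ∑ x, q x * M a x ∨ (2 : ℝ) ^ (-r) < -1 * ∑ x, q x * M a x := by
    intro a ha
    have hin : nInner (M a) f = (∑ x, f x / s * M a x) * (s / n) := by
      rw [nInner, expE, ← hn_def, Finset.sum_mul, Finset.sum_div]
      refine Finset.sum_congr rfl fun x _ => ?_
      field_simp
    rw [hin, hnorm1, abs_mul, abs_of_pos (div_pos hs hn),
      mul_le_mul_iff_left₀ (div_pos hs hn)] at ha
    have hc := abs_lt.mp (hclose a)
    rcases le_abs.mp ha with h | h
    · left; linarith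
    · right; linarith
  have hcount (σ : ℝ) (hσ : |σ| = 1) := hext.card_le hq hq1 hqle' hσ
    (Finset.univ.filter fun a => (2 : ℝ) ^ (-r) < σ * ∑ x, q x * M a x)
    fun a ha => (Finset.mem_filter.mp ha).2
  have hsplit : ((Finset.univ.filter (fun a : A =>
      ((2 : ℝ) ^ (-r) + (2 : ℝ) ^ (-ξ + 1)) * nNorm1 f ≤ |nInner (M a) f|)).card : ℝ) ≤
      ((Finset.univ.filter fun a => (2 : ℝ) ^ (-r) < 1 * ∑ x, q x * M a x).card : ℝ) +
      ((Finset.univ.filter fun a => (2 : ℝ) ^ (-r) < -1 * ∑ x, q x * M a x).card : ℝ) := by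
    rw [← Nat.cast_add]
    refine le_trans ?_ (Nat.cast_le.mpr (Finset.card_union_le _ _))
    refine Nat.cast_le.mpr (Finset.card_le_card fun a ha => ?_)
    rw [Finset.mem_union, Finset.mem_filter, Finset.mem_filter]
    exact (hbad a (Finset.mem_filter.mp ha).2).imp
      (fun h => ⟨Finset.mem_univ _, h⟩) (fun h => ⟨Finset.mem_univ _, h⟩)
  have hpos := hcount 1 (by simp)
  have hneg := hcount (-1) (by simp)
  have hk : (2 : ℝ) ^ (-(k - 1)) = 2 * 2 ^ (-k) := by
    rw [neg_sub, sub_eq_neg_add, Real.rpow_add_one two_ne_zero, mul_comm]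
  rw [hk]
  linarith
end

section
/- Let A, X be finite sets, n = log₂|X|, and ε > 0. Let M : A × X → {-1,1} be a matrix whose largest singular value satisfies σ_max(M) ≤ |A|^{1/2}·|X|^{1/2−ε}; equivalently, for every f : X → ℝ, (∑_{a∈A}(∑_{x∈X} M(a,x)·f(x))²)^{1/2} ≤ |A|^{1/2}·|X|^{1/2−ε}·(∑_{x∈X} f(x)²)^{1/2}. Then for all reals k, ℓ, r > 0 with k + 2ℓ + 2r ≤ 2εn, M is a (k,ℓ)-L₂-extractor with error 2^{-r}. -/
open Finset

attribute [local instance] Classical.propDecidable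

theorem nNorm1_pos {X : Type*} [Fintype X] {f : X → ℝ} (hf : f ≠ 0) : 0 < nNorm1 f := by
  obtain ⟨x, hx⟩ := Function.ne_iff.mp hf
  have : Nonempty X := ⟨x⟩
  have hsum : 0 < ∑ x, |f x| :=
    Finset.sum_pos' (fun _ _ => abs_nonneg _) ⟨x, Finset.mem_univ x, abs_pos.mpr hx⟩
  exact div_pos hsum (Nat.cast_pos.mpr Fintype.card_pos)

theorem nNorm2_sq {X : Type*} [Fintype X] (f : X → ℝ) :
    nNorm2 f ^ 2 = (∑ x, f x ^ 2) / Fintype.card X :=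
  Real.sq_sqrt (div_nonneg (Finset.sum_nonneg fun _ _ => sq_nonneg _) (Nat.cast_nonneg _))

theorem card_filter_le_abs_mul_sq_le_sum_sq {A : Type*} [Fintype A] (g : A → ℝ) {t : ℝ}
    (ht : 0 ≤ t) :
    ((Finset.univ.filter fun a => t ≤ |g a|).card : ℝ) * t ^ 2 ≤ ∑ a, g a ^ 2 := by
  rw [← nsmul_eq_mul]
  refine (Finset.card_nsmul_le_sum _ (fun a => g a ^ 2) _ fun a ha => ?_).trans
    (Finset.sum_le_univ_sum_of_nonneg fun a => sq_nonneg (g a))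
  rw [← sq_abs (g a)]
  exact pow_le_pow_left₀ ht (Finset.mem_filter.mp ha).2 2

/-- The singular value bound in normalized form. -/
theorem sum_nInner_sq_le {A X : Type*} [Fintype A] [Fintype X] [Nonempty X]
    (M : A → X → ℝ) (ε : ℝ) (f : X → ℝ)
    (hσ : Real.sqrt (∑ a, (∑ x, M a x * f x) ^ 2)
        ≤ (Fintype.card A : ℝ) ^ ((1 : ℝ) / 2)
          * (Fintype.card X : ℝ) ^ ((1 : ℝ) / 2 - ε)
          * Real.sqrt (∑ x, (f x) ^ 2)) :
    ∑ a, nInner (M a) f ^ 2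
      ≤ Fintype.card A * (Fintype.card X : ℝ) ^ (-(2 * ε)) * nNorm2 f ^ 2 := by
  have hN : (0 : ℝ) < Fintype.card X := Nat.cast_pos.mpr Fintype.card_pos
  have hsq := pow_le_pow_left₀ (Real.sqrt_nonneg _) hσ 2
  rw [mul_pow, mul_pow, Real.sq_sqrt (Finset.sum_nonneg fun _ _ => sq_nonneg _),
    Real.sq_sqrt (Finset.sum_nonneg fun _ _ => sq_nonneg _),
    ← Real.rpow_mul_natCast (Nat.cast_nonneg _), ← Real.rpow_mul_natCast hN.le] at hsq
  have hA : (1 : ℝ) / 2 * (2 : ℕ) = 1 := by norm_num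
  have hX : ((1 : ℝ) / 2 - ε) * (2 : ℕ) = 1 + -(2 * ε) := by push_cast; ring
  rw [hA, hX, Real.rpow_one, Real.rpow_add hN, Real.rpow_one] at hsq
  simp only [nInner, expE, div_pow, ← Finset.sum_div]
  rw [nNorm2_sq, div_le_iff₀ (by positivity)]
  refine hsq.trans_eq ?_
  field_simp

/-- **Lemma (small matrix norm implies L₂-extractor).**
If `σ_max(M) ≤ |A|^{1/2}·|X|^{1/2-ε}`, i.e. for every `f : X → ℝ`,
`(∑_a (∑_x M(a,x)·f(x))²)^{1/2} ≤ |A|^{1/2}·|X|^{1/2-ε}·(∑_x f(x)²)^{1/2}`,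
then for all `k, ℓ, r > 0` with `k + 2ℓ + 2r ≤ 2εn` (`n = log₂|X|`), the
matrix `M` is a `(k,ℓ)`-L₂-extractor with error `2^{-r}`. -/
theorem smallNorm_l2Extractor {A X : Type*} [Fintype A] [Fintype X]
    (M : A → X → ℝ) (hM : ∀ a x, M a x = 1 ∨ M a x = -1)
    (ε : ℝ) (hε : 0 < ε)
    (hσ : ∀ f : X → ℝ,
      Real.sqrt (∑ a, (∑ x, M a x * f x) ^ 2)
        ≤ (Fintype.card A : ℝ) ^ ((1 : ℝ) / 2)
          * (Fintype.card X : ℝ) ^ ((1 : ℝ) / 2 - ε)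
          * Real.sqrt (∑ x, (f x) ^ 2)) :
    ∀ k ℓ r : ℝ, 0 < k → 0 < ℓ → 0 < r →
      k + 2 * ℓ + 2 * r ≤ 2 * ε * Real.logb 2 (Fintype.card X) →
      IsL2Extractor M k ℓ r := by
  intro k ℓ r _ _ _ hk f _ hf hf2
  have : Nonempty X := (Function.ne_iff.mp hf).nonempty
  have hN : (0 : ℝ) < Fintype.card X := Nat.cast_pos.mpr Fintype.card_pos
  have h1 := nNorm1_pos hf
  have hr : (0 : ℝ) < 2 ^ (-r) := by positivity
  have hexp : (Fintype.card X : ℝ) ^ (-(2 * ε)) * ((2 : ℝ) ^ ℓ) ^ 2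
      ≤ (2 : ℝ) ^ (-k) * ((2 : ℝ) ^ (-r)) ^ 2 := by
    conv_lhs => rw [← Real.rpow_logb two_pos (by norm_num) hN]
    rw [← Real.rpow_mul two_pos.le, ← Real.rpow_mul_natCast two_pos.le,
      ← Real.rpow_mul_natCast two_pos.le, ← Real.rpow_add two_pos, ← Real.rpow_add two_pos]
    refine Real.rpow_le_rpow_of_exponent_le one_le_two ?_
    push_cast
    linarith
  refine le_of_mul_le_mul_right ?_ (pow_pos (mul_pos hr h1) 2)
  calc _ ≤ ∑ a, nInner (M a) f ^ 2 :=
        card_filter_le_abs_mul_sq_le_sum_sq _ (mul_pos hr h1).le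
    _ ≤ Fintype.card A * (Fintype.card X : ℝ) ^ (-(2 * ε)) * nNorm2 f ^ 2 :=
        sum_nInner_sq_le M ε f (hσ f)
    _ ≤ Fintype.card A * (Fintype.card X : ℝ) ^ (-(2 * ε)) * ((2 : ℝ) ^ ℓ * nNorm1 f) ^ 2 := by
        gcongr
        exact Real.sqrt_nonneg _
    _ = Fintype.card A * ((Fintype.card X : ℝ) ^ (-(2 * ε)) * ((2 : ℝ) ^ ℓ) ^ 2)
          * nNorm1 f ^ 2 := by ring
    _ ≤ Fintype.card A * ((2 : ℝ) ^ (-k) * ((2 : ℝ) ^ (-r)) ^ 2) * nNorm1 f ^ 2 := by gcongr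
    _ = _ := by ring
end
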